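/- For all indices 1 ≤ i, j ≤ n, the element e_{ij}[0] · cdet(τ + E[−1]) of U lies in the left ideal I of U generated by all elements e_{kl}[r] with r ≥ 0. (That is, e_{ij}[0] annihilates cdet(τ + E[−1]) in the quotient module U/I.) -/

import Mathlib

open scoped BigOperators

/-- Generators of the Lie algebra `L`: the elements `e_{ij}[r]`, the central
element `K` and the element `τ`. -/
inductive AffGen (n : ℕ) : Type
  | E : Fin n → Fin n → ℤ → AffGen n
  | K : AffGen n
  | T : AffGen n

/-- The defining relations of the universal enveloping algebra `U(L)`:
`K` is central, `[τ, e_{ij}[r]] = -r e_{ij}[r-1]`, `[τ, K] = 0`, and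
`[e_{ij}[r], e_{kl}[s]] = δ_{kj} e_{il}[r+s] - δ_{il} e_{kj}[r+s]
  + r δ_{r,-s} (δ_{kj} δ_{il} - δ_{ij} δ_{kl}/n) K`. -/
inductive AffRel (n : ℕ) :
    FreeAlgebra ℂ (AffGen n) → FreeAlgebra ℂ (AffGen n) → Prop
  | KE (i j : Fin n) (r : ℤ) :
      AffRel n (FreeAlgebra.ι ℂ (AffGen.K : AffGen n) * FreeAlgebra.ι ℂ (AffGen.E i j r))
            (FreeAlgebra.ι ℂ (AffGen.E i j r) * FreeAlgebra.ι ℂ (AffGen.K : AffGen n))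
  | KT :
      AffRel n (FreeAlgebra.ι ℂ (AffGen.K : AffGen n) * FreeAlgebra.ι ℂ (AffGen.T : AffGen n))
            (FreeAlgebra.ι ℂ (AffGen.T : AffGen n) * FreeAlgebra.ι ℂ (AffGen.K : AffGen n))
  | TE (i j : Fin n) (r : ℤ) :
      AffRel n (FreeAlgebra.ι ℂ (AffGen.T : AffGen n) * FreeAlgebra.ι ℂ (AffGen.E i j r)
              - FreeAlgebra.ι ℂ (AffGen.E i j r) * FreeAlgebra.ι ℂ (AffGen.T : AffGen n))
            ((-r : ℂ) • FreeAlgebra.ι ℂ (AffGen.E i j (r - 1)))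
  | EE (i j k l : Fin n) (r s : ℤ) :
      AffRel n (FreeAlgebra.ι ℂ (AffGen.E i j r) * FreeAlgebra.ι ℂ (AffGen.E k l s)
              - FreeAlgebra.ι ℂ (AffGen.E k l s) * FreeAlgebra.ι ℂ (AffGen.E i j r))
            ((if k = j then FreeAlgebra.ι ℂ (AffGen.E i l (r + s)) else 0)
              - (if i = l then FreeAlgebra.ι ℂ (AffGen.E k j (r + s)) else 0)
              + (((r : ℂ) * (if r = -s then (1 : ℂ) else 0) *
                    ((if k = j then (1 : ℂ) else 0) * (if i = l then (1 : ℂ) else 0)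
                      - (if i = j then (1 : ℂ) else 0) * (if k = l then (1 : ℂ) else 0)
                          / (n : ℂ))) •
                  FreeAlgebra.ι ℂ (AffGen.K : AffGen n)))

/-- The universal enveloping algebra `U = U(L)`. -/
abbrev UEA (n : ℕ) : Type := RingQuot (AffRel n)

/-- The element `e_{ij}[r]` of `U`. -/
noncomputable def eGen (n : ℕ) (i j : Fin n) (r : ℤ) : UEA n :=
  RingQuot.mkAlgHom ℂ (AffRel n) (FreeAlgebra.ι ℂ (AffGen.E i j r))

/-- The central element `K` of `U`. -/
noncomputable def KGen (n : ℕ) : UEA n :=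
  RingQuot.mkAlgHom ℂ (AffRel n) (FreeAlgebra.ι ℂ (AffGen.K : AffGen n))

/-- The element `τ` of `U`. -/
noncomputable def tauGen (n : ℕ) : UEA n :=
  RingQuot.mkAlgHom ℂ (AffRel n) (FreeAlgebra.ι ℂ (AffGen.T : AffGen n))

/-- The column-determinant of a matrix over a (noncommutative) ring:
`cdet A = Σ_σ sgn σ · a_{σ(1)1} a_{σ(2)2} ⋯ a_{σ(n)n}`, factors ordered by
column index. -/
noncomputable def cdet {R : Type*} [Ring R] {n : ℕ} (A : Matrix (Fin n) (Fin n) R) : R :=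
  ∑ σ : Equiv.Perm (Fin n),
    (Equiv.Perm.sign σ : ℤ) • (List.ofFn fun j : Fin n => A (σ j) j).prod

/-- The matrix `τ + E[-1]`, with `(i,j)` entry `δ_{ij} τ + e_{ij}[-1]`. -/
noncomputable def tauE (n : ℕ) : Matrix (Fin n) (Fin n) (UEA n) :=
  Matrix.of fun i j => (if i = j then tauGen n else 0) + eGen n i j (-1)

/-- The subalgebra `U(g₋)` of `U` generated by the `e_{ij}[r]` with `r < 0`. -/
noncomputable def Uneg (n : ℕ) : Subalgebra ℂ (UEA n) :=
  Algebra.adjoin ℂ {x : UEA n | ∃ i j : Fin n, ∃ r : ℤ, r < 0 ∧ x = eGen n i j r}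

/-- The left ideal `I` of `U` generated by the `e_{ij}[r]` with `r ≥ 0`. -/
noncomputable def Ipos (n : ℕ) : Submodule (UEA n) (UEA n) :=
  Submodule.span (UEA n)
    {x : UEA n | ∃ i j : Fin n, ∃ r : ℤ, 0 ≤ r ∧ x = eGen n i j r}

/-- The left submodule `(K + n)·U + I` of `U` (note `K + n` is central,
so `(K+n)·U = U·(K+n)`). -/
noncomputable def KnI (n : ℕ) : Submodule (UEA n) (UEA n) :=
  Submodule.span (UEA n)
    (insert (KGen n + (n : UEA n))
      {x : UEA n | ∃ i j : Fin n, ∃ r : ℤ, 0 ≤ r ∧ x = eGen n i j r})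

section ListProd

attribute [local instance] LieRing.ofAssociativeRing

variable {R : Type*} [Ring R]

theorem List.exists_prod_ofFn_update {n : ℕ} (f : Fin n → R) (i : Fin n) :
    ∃ p s : R, ∀ a : R, (List.ofFn (Function.update f i a)).prod = p * a * s := by
  induction n with
  | zero => exact i.elim0
  | succ n ih =>
    cases i using Fin.cases with
    | zero =>
      refine ⟨1, (List.ofFn fun l : Fin n => f l.succ).prod, fun a => ?_⟩
      simp [List.ofFn_succ, Function.update]
    | succ i =>
      obtain ⟨p, s, h⟩ := ih (fun l => f l.succ) i
      refine ⟨f 0 * p, s, fun a => ?_⟩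
      have hu : (fun l : Fin n => Function.update f i.succ a l.succ) =
          Function.update (fun l => f l.succ) i a :=
        Function.update_comp_eq_of_injective f (Fin.succ_injective n) i a
      rw [List.ofFn_succ, List.prod_cons, hu, h, Function.update_of_ne (Fin.succ_ne_zero i).symm]
      noncomm_ring

theorem List.exists_prod_ofFn_adjacent {n : ℕ} (f : Fin (n + 1) → R) (i : Fin n) :
    ∃ p s : R, ∀ g : Fin (n + 1) → R,
      (∀ l, l ≠ i.castSucc → l ≠ i.succ → g l = f l) →
        (List.ofFn g).prod = p * (g i.castSucc * g i.succ) * s := by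
  induction n with
  | zero => exact i.elim0
  | succ n ih =>
    cases i using Fin.cases with
    | zero =>
      refine ⟨1, (List.ofFn fun l : Fin n => f l.succ.succ).prod, fun g hg => ?_⟩
      have hs : (fun l : Fin n => g l.succ.succ) = fun l => f l.succ.succ :=
        funext fun l => hg _ (Fin.succ_ne_zero _)
          fun h => Fin.succ_ne_zero l (Fin.succ_injective _ h)
      simp only [List.ofFn_succ, List.prod_cons, hs, Fin.castSucc_zero]
      noncomm_ring
    | succ i =>
      obtain ⟨p, s, h⟩ := ih (fun l => f l.succ) i
      refine ⟨f 0 * p, s, fun g hg => ?_⟩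
      have h0 : g 0 = f 0 := by
        refine hg 0 ?_ (Fin.succ_ne_zero _).symm
        rw [← Fin.succ_castSucc]
        exact (Fin.succ_ne_zero _).symm
      rw [List.ofFn_succ, List.prod_cons, h (fun l => g l.succ), h0, ← Fin.succ_castSucc]
      · noncomm_ring
      · intro l h1 h2
        refine hg _ ?_ fun h => h2 (Fin.succ_injective _ h)
        rw [← Fin.succ_castSucc]
        exact fun h => h1 (Fin.succ_injective _ h)

theorem List.prod_ofFn_update_sub {n : ℕ} (f : Fin n → R) (i : Fin n) (a b : R) :
    (List.ofFn (Function.update f i (a - b))).prod =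
      (List.ofFn (Function.update f i a)).prod - (List.ofFn (Function.update f i b)).prod := by
  obtain ⟨p, s, h⟩ := List.exists_prod_ofFn_update f i
  rw [h, h, h]
  noncomm_ring

theorem List.prod_ofFn_update_zero {n : ℕ} (f : Fin n → R) (i : Fin n) :
    (List.ofFn (Function.update f i 0)).prod = 0 := by
  obtain ⟨p, s, h⟩ := List.exists_prod_ofFn_update f i
  simp [h]

theorem List.lie_prod_ofFn {n : ℕ} (x : R) (f : Fin n → R) :
    ⁅x, (List.ofFn f).prod⁆ = ∑ i, (List.ofFn (Function.update f i ⁅x, f i⁆)).prod := by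
  induction n with
  | zero => simp [Ring.lie_def]
  | succ n ih =>
    have hu : ∀ (i : Fin n) (a : R), (fun l : Fin n => Function.update f i.succ a l.succ) =
        Function.update (fun l => f l.succ) i a :=
      fun i a => Function.update_comp_eq_of_injective f (Fin.succ_injective n) i a
    have h0 : ∀ (i : Fin n) (a : R), Function.update f i.succ a 0 = f 0 :=
      fun i a => Function.update_of_ne (Fin.succ_ne_zero i).symm _ _
    have hs : ∀ a : R, (fun l : Fin n => Function.update f 0 a l.succ) = fun l => f l.succ :=
      fun a => funext fun l => Function.update_of_ne (Fin.succ_ne_zero l) _ _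
    simp only [Fin.sum_univ_succ, List.ofFn_succ, List.prod_cons, hu, h0, hs,
      Function.update_self, ← Finset.mul_sum, ← ih]
    simp only [Ring.lie_def]
    noncomm_ring

end ListProd

section Manin

attribute [local instance] LieRing.ofAssociativeRing

variable {R : Type*} [Ring R] {n : ℕ}

/-- A Manin matrix: commutators of cross terms of every `2 × 2` submatrix agree. -/
def Matrix.IsManin (A : Matrix (Fin n) (Fin n) R) : Prop :=
  ∀ i j k l, ⁅A i j, A k l⁆ = ⁅A k j, A i l⁆

theorem Matrix.IsManin.submatrix {A : Matrix (Fin n) (Fin n) R} (hA : A.IsManin)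
    (r c : Fin n → Fin n) : (A.submatrix r c).IsManin :=
  fun _ _ _ _ => hA _ _ _ _

theorem cdet_submatrix_of_row_eq (A : Matrix (Fin n) (Fin n) R) {r : Fin n → Fin n}
    {i j : Fin n} (hij : i ≠ j) (hr : r i = r j) : cdet (A.submatrix r id) = 0 := by
  refine Finset.sum_involution (fun σ _ => Equiv.swap i j * σ) ?_ ?_
    (fun _ _ => Finset.mem_univ _) (fun σ _ => Equiv.swap_mul_self_mul i j σ)
  · intro σ _
    have h : ∀ l, r (Equiv.swap i j l) = r l := by
      intro l
      rw [Equiv.swap_apply_def]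
      split_ifs with h1 h2 <;> simp_all
    simp [Equiv.Perm.sign_mul, Equiv.Perm.sign_swap hij, h]
  · intro σ _ _ h
    exact hij (Equiv.swap_eq_one_iff.1 (mul_eq_right.1 h))

theorem Matrix.IsManin.cdet_submatrix_adjacent_swap {A : Matrix (Fin (n + 1)) (Fin (n + 1)) R}
    (hA : A.IsManin) (i : Fin n) :
    cdet (A.submatrix id (Equiv.swap i.castSucc i.succ)) = -cdet A := by
  set s := Equiv.swap i.castSucc i.succ
  have hne : i.castSucc ≠ i.succ := Fin.castSucc_lt_succ.ne
  have hsl : s i.castSucc = i.succ := Equiv.swap_apply_left _ _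
  have hsr : s i.succ = i.castSucc := Equiv.swap_apply_right _ _
  have hsn : ∀ l, l ≠ i.castSucc → l ≠ i.succ → s l = l :=
    fun l h1 h2 => Equiv.swap_apply_of_ne_of_ne h1 h2
  have hsign : Equiv.Perm.sign s = -1 := Equiv.Perm.sign_swap hne
  have hre : cdet (A.submatrix id s) =
      -∑ σ : Equiv.Perm (Fin (n + 1)), (Equiv.Perm.sign σ : ℤ) •
        (List.ofFn fun l => A (σ (s l)) (s l)).prod := by
    rw [cdet, ← Equiv.sum_comp (Equiv.mulRight s), ← Finset.sum_neg_distrib]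
    simp [hsign]
  rw [hre, neg_inj, eq_comm, ← sub_eq_zero, cdet, ← Finset.sum_sub_distrib]
  refine Finset.sum_involution (fun σ _ => σ * s) ?_ ?_
    (fun _ _ => Finset.mem_univ _) (fun σ _ => Equiv.mul_swap_mul_self _ _ σ)
  · intro σ _
    obtain ⟨p, t, h⟩ := List.exists_prod_ofFn_adjacent (fun l => A (σ l) l) i
    have hm := hA (σ i.castSucc) i.castSucc (σ i.succ) i.succ
    rw [h (fun l => A (σ l) l) (fun _ _ _ => rfl),
      h (fun l => A (σ (s l)) (s l)) (fun l h1 h2 => by rw [hsn l h1 h2]),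
      h (fun l => A ((σ * s) l) l) (fun l h1 h2 => by rw [Equiv.Perm.mul_apply, hsn l h1 h2]),
      h (fun l => A ((σ * s) (s l)) (s l))
        (fun l h1 h2 => by rw [Equiv.Perm.mul_apply, hsn l h1 h2, hsn l h1 h2]),
      ← smul_sub, ← smul_sub, Equiv.Perm.sign_mul, hsign]
    simp only [Equiv.Perm.mul_apply, hsl, hsr, mul_neg, mul_one, Units.val_neg, neg_smul,
      ← mul_sub, ← sub_mul]
    rw [Ring.lie_def, Ring.lie_def] at hm
    rw [hm, add_neg_cancel]
  · intro σ _ _ h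
    exact hne (Equiv.swap_eq_one_iff.1 (mul_eq_left.1 h))

theorem Matrix.IsManin.cdet_submatrix_perm {A : Matrix (Fin n) (Fin n) R}
    (hA : A.IsManin) (π : Equiv.Perm (Fin n)) :
    cdet (A.submatrix id π) = (Equiv.Perm.sign π : ℤ) • cdet A := by
  cases n with
  | zero => simp [Subsingleton.elim π 1]
  | succ n =>
    have hπ : π ∈ Submonoid.closure
        (Set.range fun i : Fin n => Equiv.swap i.castSucc i.succ) := by
      rw [Equiv.Perm.mclosure_swap_castSucc_succ]
      trivial
    induction hπ using Submonoid.closure_induction_right with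
    | one => simp
    | mul_right π _ s hs ih =>
      obtain ⟨i, rfl⟩ := hs
      have h := (hA.submatrix id π).cdet_submatrix_adjacent_swap i
      rw [Matrix.submatrix_submatrix, ih] at h
      simpa [Equiv.Perm.sign_swap Fin.castSucc_lt_succ.ne] using h

theorem Matrix.IsManin.cdet_submatrix_of_col_eq [IsAddTorsionFree R]
    {A : Matrix (Fin n) (Fin n) R} (hA : A.IsManin) {c : Fin n → Fin n} {i j : Fin n}
    (hij : i ≠ j) (hc : c i = c j) : cdet (A.submatrix id c) = 0 := by
  have h := (hA.submatrix id c).cdet_submatrix_perm (Equiv.swap i j)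
  have hs : c ∘ Equiv.swap i j = c := by
    funext l
    rw [Function.comp_apply, Equiv.swap_apply_def]
    split_ifs with h1 h2 <;> simp_all
  rw [Matrix.submatrix_submatrix, hs] at h
  simpa [Equiv.Perm.sign_swap hij, self_eq_neg] using h

theorem lie_cdet_of_lie_apply {A : Matrix (Fin n) (Fin n) R} {x : R} {i j : Fin n}
    (hx : ∀ k l, ⁅x, A k l⁆ = (if k = j then A i l else 0) - (if i = l then A k j else 0)) :
    ⁅x, cdet A⁆ = cdet (A.submatrix (Function.update id j i) id) -
      cdet (A.submatrix id (Function.update id i j)) := by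
  simp only [cdet, lie_sum, ← Finset.sum_sub_distrib]
  refine Finset.sum_congr rfl fun σ _ => ?_
  rw [lie_zsmul, List.lie_prod_ofFn, ← smul_sub]
  simp only [hx, List.prod_ofFn_update_sub, Finset.sum_sub_distrib]
  congr 3
  · rw [Finset.sum_eq_single (σ.symm j)]
    · congr 2
      funext l
      rcases eq_or_ne l (σ.symm j) with rfl | h
      · simp
      · have h' : σ l ≠ j := fun e => h (σ.eq_symm_apply.2 e)
        simp [h, h']
    · intro l _ h
      rw [if_neg fun e => h (σ.eq_symm_apply.2 e), List.prod_ofFn_update_zero]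
    · simp
  · rw [Finset.sum_eq_single i]
    · congr 2
      funext l
      rcases eq_or_ne l i with rfl | h
      · simp
      · simp [h]
    · intro l _ h
      rw [if_neg h.symm, List.prod_ofFn_update_zero]
    · simp

theorem Matrix.IsManin.lie_cdet_eq_zero [IsAddTorsionFree R] {A : Matrix (Fin n) (Fin n) R}
    (hA : A.IsManin) {x : R} {i j : Fin n}
    (hx : ∀ k l, ⁅x, A k l⁆ = (if k = j then A i l else 0) - (if i = l then A k j else 0)) :
    ⁅x, cdet A⁆ = 0 := by
  rw [lie_cdet_of_lie_apply hx]
  rcases eq_or_ne i j with rfl | hij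
  · have hu : Function.update id i i = id := Function.update_eq_self i (id : Fin n → Fin n)
    rw [hu, sub_self]
  · rw [cdet_submatrix_of_row_eq A hij (by simp [hij]),
      hA.cdet_submatrix_of_col_eq hij (by simp [hij.symm]), sub_zero]

end Manin

section Affine

attribute [local instance] LieRing.ofAssociativeRing

variable (n : ℕ)

theorem lie_tauGen_eGen (i j : Fin n) (r : ℤ) :
    ⁅tauGen n, eGen n i j r⁆ = (-r : ℂ) • eGen n i j (r - 1) := by
  have hrel := RingQuot.mkAlgHom_rel ℂ (AffRel.TE (n := n) i j r)
  rwa [map_sub, map_mul, map_mul, map_smul] at hrel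

theorem lie_eGen_eGen_of_mul_eq_zero (i j k l : Fin n) {r s : ℤ} (h : r = 0 ∨ r ≠ -s) :
    ⁅eGen n i j r, eGen n k l s⁆ =
      (if k = j then eGen n i l (r + s) else 0) - (if i = l then eGen n k j (r + s) else 0) := by
  have hrel := RingQuot.mkAlgHom_rel ℂ (AffRel.EE (n := n) i j k l r s)
  have hc : (r : ℂ) * (if r = -s then (1 : ℂ) else 0) = 0 := by
    rcases h with rfl | h <;> simp [*]
  rw [hc, zero_mul, zero_smul, add_zero] at hrel
  simp only [map_sub, map_mul, apply_ite (RingQuot.mkAlgHom ℂ (AffRel n)), map_zero] at hrel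
  exact hrel

theorem tauE_isManin : (tauE n).IsManin := by
  have hτ : ∀ i j, ⁅tauGen n, eGen n i j (-1)⁆ = eGen n i j (-2) := by
    intro i j
    simp [lie_tauGen_eGen]
  have hτ' : ∀ i j, ⁅eGen n i j (-1), tauGen n⁆ = -eGen n i j (-2) := by
    intro i j
    rw [← lie_skew, hτ]
  intro i j k l
  have he : ∀ i j k l : Fin n, ⁅tauE n i j, tauE n k l⁆ =
      (if i = j then eGen n k l (-2) else 0) - (if k = l then eGen n i j (-2) else 0) +
        ((if k = j then eGen n i l (-2) else 0) - (if i = l then eGen n k j (-2) else 0)) := by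
    intro i j k l
    simp only [tauE, Matrix.of_apply, add_lie, lie_add,
      lie_eGen_eGen_of_mul_eq_zero n i j k l (r := -1) (s := -1) (by norm_num)]
    split_ifs <;> simp [hτ, hτ'] <;> abel
  rw [he, he]
  abel

theorem lie_eGen_zero_tauE (i j k l : Fin n) :
    ⁅eGen n i j 0, tauE n k l⁆ =
      (if k = j then tauE n i l else 0) - (if i = l then tauE n k j else 0) := by
  have hτ : ⁅eGen n i j 0, tauGen n⁆ = 0 := by
    rw [← lie_skew, lie_tauGen_eGen]
    simp
  have hτ' : ⁅eGen n i j 0, if k = l then tauGen n else 0⁆ = 0 := by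
    split_ifs <;> simp [hτ]
  simp only [tauE, Matrix.of_apply, lie_add, hτ',
    lie_eGen_eGen_of_mul_eq_zero n i j k l (Or.inl rfl), zero_add]
  split_ifs <;> simp_all

end Affine

theorem commute_eGen_zero_cdet_tauE (n : ℕ) (i j : Fin n) :
    Commute (eGen n i j 0) (cdet (tauE n)) := by
  have : IsAddTorsionFree (UEA n) := IsAddTorsionFree.of_isTorsionFree ℂ _
  exact commute_iff_lie_eq.2 ((tauE_isManin n).lie_cdet_eq_zero (lie_eGen_zero_tauE n i j))

/-- for all `i, j`, the element `e_{ij}[0] · cdet(τ + E[-1])`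
lies in the left ideal `I` of `U` generated by all `e_{kl}[r]` with `r ≥ 0`. -/
theorem e_zero_mul_cdet_mem_I (n : ℕ) (hn : 1 ≤ n) (i j : Fin n) :
    eGen n i j 0 * cdet (tauE n) ∈ Ipos n := by
  rw [(commute_eGen_zero_cdet_tauE n i j).eq]
  exact Submodule.smul_mem _ _ (Submodule.subset_span ⟨i, j, 0, le_rfl, rfl⟩)
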